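/- Let d = 2. Let u : ℝ² → ℝ² be a continuously differentiable vector field and set v = u ∘ Φ on ℝ² \ {0}. Define β(r) = ζ(r)ζ'(r)/r and the matrix field K by K(y)w = (ζ(|y|)/|y|) P_y(w) + ζ'(|y|)(w − P_y(w)). Then for every x ∈ ℝ² with x ≠ 0, writing r = |x|, the divergences satisfy (div u)(Φ(x)) = β(r)⁻¹ · div( y ↦ K(y) v(y) )(x). -/

import Mathlib

open scoped RealInnerProductSpace

noncomputable section

/-- The orthogonal projection of `w` onto the span of `e_r = x/‖x‖`. -/
def radialProj {E : Type*} [NormedAddCommGroup E] [InnerProductSpace ℝ E]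
    (x w : E) : E :=
  ⟪w, ‖x‖⁻¹ • x⟫ • (‖x‖⁻¹ • x)

/-- The divergence of a vector field: the trace of its Jacobian. -/
def diverg {E : Type*} [NormedAddCommGroup E] [NormedSpace ℝ E]
    (u : E → E) (x : E) : ℝ :=
  LinearMap.trace ℝ E (fderiv ℝ u x)

section Calculus

variable {E : Type*} [NormedAddCommGroup E] [InnerProductSpace ℝ E]

theorem HasDerivAt.hasFDerivAt_comp_norm {f : ℝ → ℝ} {f' : ℝ} {x : E} (hx : x ≠ 0)
    (hf : HasDerivAt f f' ‖x‖) :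
    HasFDerivAt (fun y : E => f ‖y‖) ((f' / ‖x‖) • innerSL ℝ x) x := by
  have hr : ‖x‖ ≠ 0 := norm_ne_zero_iff.2 hx
  have hnorm : HasFDerivAt (fun y : E => ‖y‖) (‖x‖⁻¹ • innerSL ℝ x) x := by
    have h := (hasStrictFDerivAt_norm_sq x).hasFDerivAt.sqrt (pow_ne_zero 2 hr)
    simp only [Real.sqrt_sq (norm_nonneg _)] at h
    convert h using 1
    ext w
    simp
    field_simp
  rw [div_eq_mul_inv, mul_smul]
  exact hf.comp_hasFDerivAt x hnorm

/-- The field `y ↦ a(|y|) P_y w + b(|y|) (w - P_y w)`, with the singular factors collected. -/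
theorem smul_radialProj_add_smul_sub (a b : ℝ) (y w : E) :
    a • radialProj y w + b • (w - radialProj y w) =
      b • w - ((b - a) / ‖y‖ ^ 2 * ⟪w, y⟫) • y := by
  have h : radialProj y w = (⟪w, y⟫ / ‖y‖ ^ 2) • y := by
    rw [radialProj, real_inner_smul_right, smul_smul]
    congr 1
    ring
  rw [h]
  module

theorem LinearMap.trace_comp_smul_id_add_smulRight [FiniteDimensional ℝ E]
    (A : E →L[ℝ] E) (a : ℝ) (f : E →L[ℝ] ℝ) (x : E) :
    LinearMap.trace ℝ E (A ∘L (a • ContinuousLinearMap.id ℝ E + f.smulRight x)) =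
      a * LinearMap.trace ℝ E A + f (A x) := by
  have h : ((A ∘L (a • ContinuousLinearMap.id ℝ E + f.smulRight x) : E →L[ℝ] E) : E →ₗ[ℝ] E) =
      a • (A : E →ₗ[ℝ] E) + (f : E →ₗ[ℝ] ℝ).smulRight (A x) := by
    ext w
    simp
  rw [h, map_add, map_smul, LinearMap.trace_smulRight]
  simp

theorem HasFDerivAt.diverg_eq {u : E → E} {u' : E →L[ℝ] E} {x : E} (h : HasFDerivAt u u' x) :
    diverg u x = LinearMap.trace ℝ E u' := by
  rw [diverg, h.fderiv]

theorem HasFDerivAt.diverg_smul_sub_smul_id [FiniteDimensional ℝ E]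
    {f g : E → ℝ} {f' g' : E →L[ℝ] ℝ} {v : E → E} {v' : E →L[ℝ] E} {x : E}
    (hf : HasFDerivAt f f' x) (hg : HasFDerivAt g g' x) (hv : HasFDerivAt v v' x) :
    diverg (fun y => f y • v y - g y • y) x =
      f x * LinearMap.trace ℝ E v' + f' (v x) - g x * Module.finrank ℝ E - g' x := by
  have hid : HasFDerivAt (fun y : E => y) (ContinuousLinearMap.id ℝ E) x := hasFDerivAt_id x
  rw [((hf.fun_smul hv).fun_sub (hg.fun_smul hid)).diverg_eq]
  have h : ((f x • v' + f'.smulRight (v x) -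
      (g x • ContinuousLinearMap.id ℝ E + g'.smulRight x) : E →L[ℝ] E) : E →ₗ[ℝ] E) =
      f x • (v' : E →ₗ[ℝ] E) + (f' : E →ₗ[ℝ] ℝ).smulRight (v x) -
      (g x • LinearMap.id + (g' : E →ₗ[ℝ] ℝ).smulRight x) := by
    ext w
    simp
  rw [h]
  simp only [map_sub, map_add, map_smul, LinearMap.trace_smulRight, LinearMap.trace_id,
    smul_eq_mul, ContinuousLinearMap.coe_coe]
  ring

end Calculus

/-- d = 2: For the radial change of variables `Φ(x) = (ζ(|x|)/|x|) x`,
`v = u ∘ Φ`, `β(r) = ζ(r)ζ'(r)/r` and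
`K(y)w = (ζ(|y|)/|y|) P_y(w) + ζ'(|y|)(w − P_y(w))`, the divergences satisfy
`(div u)(Φ(x)) = β(r)⁻¹ · div(y ↦ K(y) v(y))(x)`, `r = |x|`. -/
theorem stmt4 (ζ : ℝ → ℝ) (hζ : ContDiff ℝ (⊤ : ℕ∞) ζ)
    (hζpos : ∀ r : ℝ, 0 < r → 0 < ζ r)
    (hζ'pos : ∀ r : ℝ, 0 < r → 0 < deriv ζ r)
    (Φ : EuclideanSpace ℝ (Fin 2) → EuclideanSpace ℝ (Fin 2))
    (hΦ : ∀ x, Φ x = (ζ ‖x‖ / ‖x‖) • x)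
    (u : EuclideanSpace ℝ (Fin 2) → EuclideanSpace ℝ (Fin 2)) (hu : ContDiff ℝ 1 u)
    (v : EuclideanSpace ℝ (Fin 2) → EuclideanSpace ℝ (Fin 2)) (hv : v = u ∘ Φ)
    (β : ℝ → ℝ) (hβ : ∀ r : ℝ, β r = ζ r * deriv ζ r / r)
    (K : EuclideanSpace ℝ (Fin 2) → EuclideanSpace ℝ (Fin 2) → EuclideanSpace ℝ (Fin 2))
    (hK : ∀ y w, K y w = (ζ ‖y‖ / ‖y‖) • radialProj y w + deriv ζ ‖y‖ • (w - radialProj y w)) :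
    ∀ x : EuclideanSpace ℝ (Fin 2), x ≠ 0 →
      diverg u (Φ x) = (β ‖x‖)⁻¹ * diverg (fun y => K y (v y)) x := by
  intro x hx
  have hr : ‖x‖ ≠ 0 := norm_ne_zero_iff.2 hx
  have hrpos : 0 < ‖x‖ := norm_pos_iff.2 hx
  have hζ1 : HasDerivAt ζ (deriv ζ ‖x‖) ‖x‖ :=
    (hζ.differentiable (by simp)).differentiableAt.hasDerivAt
  have hζ2 : HasDerivAt (deriv ζ) (deriv (deriv ζ) ‖x‖) ‖x‖ := by
    have h : ContDiff ℝ 1 (deriv ζ) :=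
      (contDiff_succ_iff_deriv (n := 1)).1 (hζ.of_le (by norm_cast)) |>.2.2
    exact (h.differentiable (by simp)).differentiableAt.hasDerivAt
  have hid : HasFDerivAt (fun y : EuclideanSpace ℝ (Fin 2) => y) (.id ℝ _) x := hasFDerivAt_id x
  have hquot := hζ1.fun_div (hasDerivAt_id' ‖x‖) hr
  have hcoef := (hζ2.fun_sub hquot).fun_div ((hasDerivAt_id' ‖x‖).fun_pow 2) (pow_ne_zero 2 hr)
  have hΦ' : HasFDerivAt Φ _ x :=
    ((hquot.hasFDerivAt_comp_norm hx).fun_smul hid).congr_of_eventuallyEq (.of_forall hΦ)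
  have hv' := ((hu.differentiable (by simp)).differentiableAt (x := Φ x)).hasFDerivAt.comp x hΦ'
  rw [← hv] at hv'
  have hg := (hcoef.hasFDerivAt_comp_norm hx).fun_mul (hv'.inner ℝ hid)
  have hK' : (fun y => K y (v y)) = fun y => deriv ζ ‖y‖ • v y -
      ((deriv ζ ‖y‖ - ζ ‖y‖ / ‖y‖) / ‖y‖ ^ 2 * ⟪v y, y⟫) • y :=
    funext fun y => by rw [hK, smul_radialProj_add_smul_sub]
  rw [hK', (hζ2.hasFDerivAt_comp_norm hx).diverg_smul_sub_smul_id hg hv',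
    LinearMap.trace_comp_smul_id_add_smulRight]
  have hζne := (hζpos _ hrpos).ne'
  have hζ'ne := (hζ'pos _ hrpos).ne'
  simp [fderivInnerCLM_apply, hβ, diverg, real_inner_comm x, inner_add_right, inner_smul_right]
  field_simp
  ring

end
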